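/- Let n ≥ 3. There is a constant C such that for every radial function f on ℝⁿ the half-wave flow satisfies ‖e^{it|D|}f‖_{L²_t L^∞_x} ≤ C‖f‖_{Ḣ^{(n−1)/2}}. -/

import Mathlib

noncomputable section

open MeasureTheory Real Complex Filter Matrix
open scoped FourierTransform ENNReal NNReal

attribute [local instance] Matrix.normedAddCommGroup

/-- Euclidean space `ℝ³`. -/
abbrev R3 : Type := EuclideanSpace ℝ (Fin 3)

/-- Spinors: elements of `ℂ⁴`. -/
abbrev Spinor : Type := Fin 4 → ℂ

/-- The Pauli matrices. -/
def pauli : Fin 3 → Matrix (Fin 2) (Fin 2) ℂ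
  | 0 => !![0, 1; 1, 0]
  | 1 => !![0, -Complex.I; Complex.I, 0]
  | 2 => !![1, 0; 0, -1]

/-- The Dirac matrices `αₖ = [[0,σₖ],[σₖ,0]]` in 2×2 block form. -/
def diracAlpha (k : Fin 3) : Matrix (Fin 4) (Fin 4) ℂ :=
  (Matrix.reindex finSumFinEquiv finSumFinEquiv
    (Matrix.fromBlocks 0 (pauli k) (pauli k) 0) : Matrix (Fin 4) (Fin 4) ℂ)

/-- The Dirac matrix `β = [[I₂,0],[0,−I₂]]`. -/
def diracBeta : Matrix (Fin 4) (Fin 4) ℂ :=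
  (Matrix.reindex finSumFinEquiv finSumFinEquiv
    (Matrix.fromBlocks (1 : Matrix (Fin 2) (Fin 2) ℂ) 0 0 (-1 : Matrix (Fin 2) (Fin 2) ℂ)) : Matrix (Fin 4) (Fin 4) ℂ)

/-- The matrix `γ₅ = [[0,I₂],[I₂,0]]`. -/
def gamma5 : Matrix (Fin 4) (Fin 4) ℂ :=
  (Matrix.reindex finSumFinEquiv finSumFinEquiv
    (Matrix.fromBlocks (0 : Matrix (Fin 2) (Fin 2) ℂ) 1 1 (0 : Matrix (Fin 2) (Fin 2) ℂ)) : Matrix (Fin 4) (Fin 4) ℂ)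

/-- `α·a = a₁α₁ + a₂α₂ + a₃α₃` for a real vector `a`. -/
def alphaD (a : Fin 3 → ℝ) : Matrix (Fin 4) (Fin 4) ℂ :=
  ∑ k, (a k : ℂ) • diracAlpha k

/-- The partial derivative `∂ₖ` of a spinor field. -/
def pd (k : Fin 3) (u : R3 → Spinor) (x : R3) : Spinor :=
  fderiv ℝ u x (EuclideanSpace.single k 1)

/-- The free Dirac operator `𝒟 = −i Σₖ αₖ ∂ₖ`. -/
def diracOp (u : R3 → Spinor) (x : R3) : Spinor :=
  (-Complex.I) • ∑ k, (diracAlpha k).mulVec (pd k u x)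

/-- The symbol `cos(t|ξ|)I₄ + i sin(t|ξ|)(α·ξ)/|ξ|` of the free Dirac propagator. -/
def diracSymb (t : ℝ) (ξ : R3) : Matrix (Fin 4) (Fin 4) ℂ :=
  (Real.cos (t * ‖ξ‖) : ℂ) • 1 +
    (Complex.I * (Real.sin (t * ‖ξ‖) : ℂ) / (‖ξ‖ : ℂ)) • alphaD (fun k => ξ k)

/-- The free Dirac propagator `e^{it𝒟}`, as the Fourier multiplier with matrix symbol
`cos(t|ξ|)I₄ + i sin(t|ξ|)(α·ξ)/|ξ|`. -/
def diracProp (t : ℝ) (f : R3 → Spinor) : R3 → Spinor :=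
  𝓕⁻ fun ξ => (diracSymb t ξ).mulVec (𝓕 f ξ)

/-- The homogeneous Sobolev norm `‖f‖_{Ḣˢ} = ‖ |ξ|ˢ f̂(ξ) ‖_{L²}`. -/
def hSob (s : ℝ) (f : R3 → Spinor) : ℝ≥0∞ :=
  eLpNorm (fun ξ : R3 => ‖ξ‖ ^ s • 𝓕 f ξ) 2 volume

/-- The mixed norm `‖u‖_{L²_t L^∞_x}`. -/
def L2Linf (u : ℝ → R3 → Spinor) : ℝ≥0∞ :=
  (∫⁻ t : ℝ, (eLpNorm (u t) ⊤ volume) ^ 2) ^ (1/2 : ℝ)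

/-- The mixed norm `‖u‖_{L²_t L²_x}`. -/
def L2L2 (u : ℝ → R3 → Spinor) : ℝ≥0∞ :=
  (∫⁻ t : ℝ, (eLpNorm (u t) 2 volume) ^ 2) ^ (1/2 : ℝ)

/-- A function on `ℝ³` is radial if it depends only on `|x|`. -/
def IsRadial {E : Type*} (f : R3 → E) : Prop :=
  ∀ x y : R3, ‖x‖ = ‖y‖ → f x = f y

/-- The class `𝓗̇¹`: `f = f₁ + 𝒟f₂` with `f₁ ∈ Ḣ¹`, `f₂ ∈ Ḣ²`, componentwise radial. -/
def Hclass (f : R3 → Spinor) : Prop :=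
  ∃ f₁ f₂ : R3 → Spinor,
    (∀ j, IsRadial fun x => f₁ x j) ∧ (∀ j, IsRadial fun x => f₂ x j) ∧
    hSob 1 f₁ < ⊤ ∧ hSob 2 f₂ < ⊤ ∧ f = f₁ + fun x => diracOp f₂ x

/-- The potential `V(x) = V₁(|x|)I₄ + iβ(α·x̂)V₂(|x|)`. -/
def potential (V₁ V₂ : ℝ → ℝ) (x : R3) : Matrix (Fin 4) (Fin 4) ℂ :=
  (V₁ ‖x‖ : ℂ) • 1 +
    (Complex.I * (V₂ ‖x‖ : ℂ)) • (diracBeta * alphaD fun k => ‖x‖⁻¹ * x k)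

/-- The size assumption `|V(x)| ≤ δ/(|x|^{1/2}|log|x||^{σ/2} + |x|^σ)`. -/
def VBound (σ δ : ℝ) (V : R3 → Matrix (Fin 4) (Fin 4) ℂ) : Prop :=
  ∀ x : R3, x ≠ 0 →
    ‖V x‖ ≤ δ / (‖x‖ ^ (1/2 : ℝ) * |Real.log ‖x‖| ^ (σ/2) + ‖x‖ ^ σ)


/-- Euclidean space `ℝⁿ`. -/
abbrev Rn (n : ℕ) : Type := EuclideanSpace ℝ (Fin n)

/-- A function on `ℝⁿ` is radial if it depends only on `|x|`. -/
def IsRadialN {n : ℕ} {E : Type*} (f : Rn n → E) : Prop :=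
  ∀ x y : Rn n, ‖x‖ = ‖y‖ → f x = f y

/-- The half-wave propagator `e^{it|D|}`: the Fourier multiplier with symbol `e^{it|ξ|}`. -/
def halfWave {n : ℕ} (t : ℝ) (f : Rn n → ℂ) : Rn n → ℂ :=
  𝓕⁻ fun ξ => Complex.exp (Complex.I * (t : ℂ) * (‖ξ‖ : ℂ)) * 𝓕 f ξ

/-- The homogeneous Sobolev norm `‖f‖_{Ḣˢ}` of a scalar function on `ℝⁿ`. -/
def hSobN {n : ℕ} (s : ℝ) (f : Rn n → ℂ) : ℝ≥0∞ :=
  eLpNorm (fun ξ : Rn n => ‖ξ‖ ^ s • 𝓕 f ξ) 2 volume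

/-- The mixed norm `‖u‖_{L²_t L^∞_x}` for scalar functions on `ℝⁿ`. -/
def L2LinfN {n : ℕ} (u : ℝ → Rn n → ℂ) : ℝ≥0∞ :=
  (∫⁻ t : ℝ, (eLpNorm (u t) ⊤ volume) ^ 2) ^ (1/2 : ℝ)

/-- The mixed norm `‖u‖_{L²_t L²_x}` for scalar functions on `ℝⁿ`. -/
def L2L2N {n : ℕ} (u : ℝ → Rn n → ℂ) : ℝ≥0∞ :=
  (∫⁻ t : ℝ, (eLpNorm (u t) 2 volume) ^ 2) ^ (1/2 : ℝ)

/-- Hardy–Littlewood weak type `(1,1)` bound on the line, for centered intervals. -/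
lemma maximal_weak_type (ψ : ℝ → ℝ≥0∞) (l : ℝ≥0∞) (hl0 : l ≠ 0) (hl : l ≠ ⊤) :
    l * volume {t : ℝ | ∃ R : ℝ, 0 < R ∧
      l * ENNReal.ofReal (2 * R) < ∫⁻ s in Metric.ball t R, ψ s} ≤ 5 * ∫⁻ s, ψ s := by
  by_cases hψ : ∫⁻ s, ψ s = ⊤
  · simp [hψ]
  set S := {t : ℝ | ∃ R : ℝ, 0 < R ∧ l * ENNReal.ofReal (2 * R) < ∫⁻ s in Metric.ball t R, ψ s}
  let T : Set (ℝ × ℝ) :=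
    {p | 0 < p.2 ∧ l * ENNReal.ofReal (2 * p.2) < ∫⁻ s in Metric.ball p.1 p.2, ψ s}
  have hbound : ∀ p ∈ T, p.2 ≤ ((∫⁻ s, ψ s) / l).toReal := by
    rintro ⟨t, R⟩ ⟨hR, hp⟩
    have h : ENNReal.ofReal (2 * R) ≤ (∫⁻ s, ψ s) / l := by
      rw [ENNReal.le_div_iff_mul_le (.inl hl0) (.inl hl), mul_comm]
      exact hp.le.trans (setLIntegral_le_lintegral _ _)
    have h2 := (ENNReal.ofReal_le_iff_le_toReal (ENNReal.div_ne_top hψ hl0)).1 h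
    dsimp only at hR ⊢
    linarith
  obtain ⟨u, huT, hdisj, hcov⟩ := Vitali.exists_disjoint_subfamily_covering_enlargement_ball T
    Prod.fst Prod.snd _ hbound 5 (by norm_num)
  have hcount : u.Countable :=
    hdisj.countable_of_isOpen (fun _ _ => Metric.isOpen_ball)
      fun p hp => ⟨p.1, Metric.mem_ball_self (huT hp).1⟩
  have hS : S ⊆ ⋃ p ∈ u, Metric.ball p.1 (5 * p.2) := by
    rintro t ⟨R, hR, ht⟩
    obtain ⟨b, hb, hsub⟩ := hcov (t, R) ⟨hR, ht⟩
    exact Set.mem_biUnion hb (hsub (Metric.mem_ball_self hR))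
  calc l * volume S ≤ l * ∑' p : u, volume (Metric.ball p.1.1 (5 * p.1.2)) := by
        gcongr
        exact (measure_mono hS).trans (measure_biUnion_le _ hcount _)
    _ = ∑' p : u, 5 * (l * ENNReal.ofReal (2 * p.1.2)) := by
        rw [← ENNReal.tsum_mul_left]
        congr with p
        rw [Real.volume_ball, show 2 * (5 * p.1.2) = 5 * (2 * p.1.2) by ring,
          ENNReal.ofReal_mul (by norm_num)]
        simp only [ENNReal.ofReal_ofNat]
        ring
    _ ≤ ∑' p : u, 5 * ∫⁻ s in Metric.ball p.1.1 p.1.2, ψ s := by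
        gcongr with p
        exact (huT p.2).2.le
    _ = 5 * ∫⁻ s in ⋃ p ∈ u, Metric.ball p.1 p.2, ψ s := by
        rw [ENNReal.tsum_mul_left,
          lintegral_biUnion hcount (fun _ _ => Metric.isOpen_ball.measurableSet) hdisj]
    _ ≤ 5 * ∫⁻ s, ψ s := by
        gcongr
        exact Measure.restrict_le_self

/-- The centered Hardy–Littlewood maximal function on the line, over rational radii. -/
def maximalFn (φ : ℝ → ℝ≥0∞) (t : ℝ) : ℝ≥0∞ :=
  ⨆ q : {q : ℚ // 0 < q},
    (∫⁻ s in Metric.ball t (q.1 : ℝ), φ s) / ENNReal.ofReal (2 * (q.1 : ℝ))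

lemma measurable_maximalFn {φ : ℝ → ℝ≥0∞} (hφ : Measurable φ) : Measurable (maximalFn φ) := by
  refine Measurable.iSup fun q => Measurable.div_const ?_ _
  simp_rw [← lintegral_indicator Metric.isOpen_ball.measurableSet]
  refine Measurable.lintegral_prod_right' (f := fun p : ℝ × ℝ =>
    (Metric.ball p.1 (q.1 : ℝ)).indicator φ p.2) ?_
  have : (fun p : ℝ × ℝ => (Metric.ball p.1 (q.1 : ℝ)).indicator φ p.2) =
      {p : ℝ × ℝ | dist p.2 p.1 < q.1}.indicator fun p => φ p.2 := by
    ext p; simp [Set.indicator, Metric.mem_ball]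
  rw [this]
  exact (hφ.comp measurable_snd).indicator
    (measurableSet_lt (measurable_snd.dist measurable_fst) measurable_const)

/-- Averages over intervals of any radius are controlled by the maximal function. -/
lemma setLIntegral_ball_le_maximalFn (φ : ℝ → ℝ≥0∞) (t : ℝ) {R : ℝ} (hR : 0 < R) :
    ∫⁻ s in Metric.ball t R, φ s ≤ ENNReal.ofReal (4 * R) * maximalFn φ t := by
  obtain ⟨q, hq, hq2⟩ := exists_rat_btwn (show R < 2 * R by linarith)
  have hq0 : (0 : ℝ) < q := hR.trans hq
  have h : (∫⁻ s in Metric.ball t q, φ s) / ENNReal.ofReal (2 * q) ≤ maximalFn φ t :=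
    le_iSup (fun q : {q : ℚ // 0 < q} =>
      (∫⁻ s in Metric.ball t (q.1 : ℝ), φ s) / ENNReal.ofReal (2 * (q.1 : ℝ)))
      ⟨q, by exact_mod_cast hq0⟩
  have hpos : ENNReal.ofReal (2 * q) ≠ 0 := by simpa using hq0
  rw [ENNReal.div_le_iff hpos ENNReal.ofReal_ne_top] at h
  calc ∫⁻ s in Metric.ball t R, φ s ≤ ∫⁻ s in Metric.ball t q, φ s :=
        lintegral_mono_set (Metric.ball_subset_ball hq.le)
    _ ≤ maximalFn φ t * ENNReal.ofReal (2 * q) := h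
    _ ≤ maximalFn φ t * ENNReal.ofReal (4 * R) :=
        mul_le_mul_right (ENNReal.ofReal_le_ofReal (by linarith)) _
    _ = _ := mul_comm _ _

lemma maximalFn_le_of_le {φ : ℝ → ℝ≥0∞} {B : ℝ≥0∞} (hB : ∀ s, φ s ≤ B) (t : ℝ) :
    maximalFn φ t ≤ B := by
  refine iSup_le fun q => ENNReal.div_le_of_le_mul ?_
  calc ∫⁻ s in Metric.ball t (q.1 : ℝ), φ s ≤ ∫⁻ s in Metric.ball t (q.1 : ℝ), B :=
        lintegral_mono fun s => hB s
    _ = _ := by rw [setLIntegral_const, Real.volume_ball]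

lemma lintegral_ite_lt_mul_two {a : ℝ≥0∞} (ha : a ≠ ⊤) :
    ∫⁻ l in Set.Ioi (0 : ℝ), (if ENNReal.ofReal l < a then ENNReal.ofReal (2 * l) else 0) =
      a ^ 2 := by
  lift a to ℝ≥0 using ha
  have h1 : ∫⁻ l in Set.Ioi (0 : ℝ),
      (if ENNReal.ofReal l < a then ENNReal.ofReal (2 * l) else 0) =
      ∫⁻ l in Set.Ioc (0 : ℝ) a, ENNReal.ofReal (2 * l) := by
    rw [← lintegral_indicator measurableSet_Ioi, setLIntegral_congr Ioo_ae_eq_Ioc.symm,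
      ← lintegral_indicator measurableSet_Ioo]
    congr with l
    by_cases h0 : 0 < l
    · simp [Set.indicator, h0, ENNReal.ofReal_lt_coe_iff h0.le]
    · simp [Set.indicator, h0]
  rw [h1, ← ofReal_integral_eq_lintegral_ofReal, ← intervalIntegral.integral_of_le a.coe_nonneg]
  · rw [intervalIntegral.integral_const_mul, integral_id]
    rw [show (2 * (((a : ℝ) ^ 2 - 0 ^ 2) / 2)) = (a : ℝ) ^ 2 by ring,
      ENNReal.ofReal_pow a.coe_nonneg, ENNReal.ofReal_coe_nnreal]
  · exact (continuous_const.mul continuous_id).integrableOn_Ioc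
  · exact (ae_restrict_iff' measurableSet_Ioc).2 (ae_of_all _ fun l hl => by
      simpa using hl.1.le)

lemma lintegral_ite_half_lt {a : ℝ≥0∞} :
    ∫⁻ l in Set.Ioi (0 : ℝ), (if ENNReal.ofReal (l / 2) < a then a else 0) ≤ 2 * a ^ 2 := by
  by_cases ha : a = ⊤
  · simp [ha]
  lift a to ℝ≥0 using ha
  calc ∫⁻ l in Set.Ioi (0 : ℝ), (if ENNReal.ofReal (l / 2) < a then (a : ℝ≥0∞) else 0)
      ≤ ∫⁻ l, (Set.Ioo (0 : ℝ) (2 * a)).indicator (fun _ => (a : ℝ≥0∞)) l := by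
        rw [← lintegral_indicator measurableSet_Ioi]
        refine lintegral_mono fun l => ?_
        by_cases h0 : 0 < l
        · by_cases h1 : ENNReal.ofReal (l / 2) < a
          · have h2 : l / 2 < a := (ENNReal.ofReal_lt_coe_iff (by positivity)).1 h1
            have : l ∈ Set.Ioo (0 : ℝ) (2 * a) := ⟨h0, by linarith⟩
            rw [Set.indicator_of_mem this, Set.indicator_of_mem (Set.mem_Ioi.2 h0), if_pos h1]
          · simp [Set.indicator, h1]
        · simp [Set.indicator, h0]
    _ = 2 * a ^ 2 := by
        rw [lintegral_indicator measurableSet_Ioo, setLIntegral_const, Real.volume_Ioo, sub_zero,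
          ENNReal.ofReal_mul (by norm_num), ENNReal.ofReal_coe_nnreal]
        simp only [ENNReal.ofReal_ofNat]
        ring

/-- The strong type `(2,2)` Hardy–Littlewood maximal inequality for bounded functions. -/
lemma lintegral_maximalFn_sq_le {φ : ℝ → ℝ≥0∞} (hφ : Measurable φ) {B : ℝ≥0∞} (hBt : B ≠ ⊤)
    (hB : ∀ s, φ s ≤ B) :
    ∫⁻ t, maximalFn φ t ^ 2 ≤ 40 * ∫⁻ s, φ s ^ 2 := by
  have hM := measurable_maximalFn hφ
  have hkey : ∀ l : ℝ, 0 < l → ENNReal.ofReal (2 * l) *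
      volume {t | ENNReal.ofReal l < maximalFn φ t} ≤
      20 * ∫⁻ s, if ENNReal.ofReal (l / 2) < φ s then φ s else 0 := by
    intro l hl
    set ψ : ℝ → ℝ≥0∞ := fun s => if ENNReal.ofReal (l / 2) < φ s then φ s else 0
    have hle : ∀ s, φ s ≤ ψ s + ENNReal.ofReal (l / 2) := by
      intro s
      by_cases h : ENNReal.ofReal (l / 2) < φ s
      · simp [ψ, h]
      · simpa [ψ, h] using le_of_not_gt h
    have hsub : {t | ENNReal.ofReal l < maximalFn φ t} ⊆ {t : ℝ | ∃ R : ℝ, 0 < R ∧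
        ENNReal.ofReal (l / 2) * ENNReal.ofReal (2 * R) < ∫⁻ s in Metric.ball t R, ψ s} := by
      intro t ht
      obtain ⟨q, hq⟩ := lt_iSup_iff.1 (show ENNReal.ofReal l < maximalFn φ t from ht)
      have hq0 : (0 : ℝ) < q.1 := by exact_mod_cast q.2
      refine ⟨q.1, hq0, ?_⟩
      by_contra! hcon
      refine absurd hq (not_lt.2 (ENNReal.div_le_of_le_mul ?_))
      calc ∫⁻ s in Metric.ball t (q.1 : ℝ), φ s
          ≤ ∫⁻ s in Metric.ball t (q.1 : ℝ), (ψ s + ENNReal.ofReal (l / 2)) :=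
            lintegral_mono fun s => hle s
        _ = (∫⁻ s in Metric.ball t (q.1 : ℝ), ψ s) +
            ENNReal.ofReal (l / 2) * ENNReal.ofReal (2 * q.1) := by
            rw [lintegral_add_right _ measurable_const, setLIntegral_const, Real.volume_ball]
        _ ≤ ENNReal.ofReal (l / 2) * ENNReal.ofReal (2 * q.1) +
            ENNReal.ofReal (l / 2) * ENNReal.ofReal (2 * q.1) := by gcongr
        _ = ENNReal.ofReal l * ENNReal.ofReal (2 * q.1) := by
            rw [← add_mul, ← ENNReal.ofReal_add (by positivity) (by positivity), add_halves]
    have hw := maximal_weak_type ψ (ENNReal.ofReal (l / 2)) (by simpa using hl)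
      ENNReal.ofReal_ne_top
    calc ENNReal.ofReal (2 * l) * volume {t | ENNReal.ofReal l < maximalFn φ t}
        = 4 * (ENNReal.ofReal (l / 2) * volume {t | ENNReal.ofReal l < maximalFn φ t}) := by
          rw [← mul_assoc, show (2 * l) = 4 * (l / 2) by ring, ENNReal.ofReal_mul (by norm_num)]
          simp
      _ ≤ 4 * (5 * ∫⁻ s, ψ s) := by
          exact mul_le_mul_right ((mul_le_mul_right (measure_mono hsub) _).trans hw) _
      _ = 20 * ∫⁻ s, ψ s := by rw [← mul_assoc]; norm_num
  calc ∫⁻ t, maximalFn φ t ^ 2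
      = ∫⁻ t, ∫⁻ l in Set.Ioi (0 : ℝ),
          (if ENNReal.ofReal l < maximalFn φ t then ENNReal.ofReal (2 * l) else 0) := by
        congr with t
        exact (lintegral_ite_lt_mul_two
          (ne_top_of_le_ne_top hBt (maximalFn_le_of_le hB t))).symm
    _ = ∫⁻ l in Set.Ioi (0 : ℝ), ∫⁻ t,
          (if ENNReal.ofReal l < maximalFn φ t then ENNReal.ofReal (2 * l) else 0) := by
        refine lintegral_lintegral_swap (Measurable.aemeasurable ?_)
        exact Measurable.ite (measurableSet_lt (by fun_prop) (by fun_prop))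
          (by fun_prop) measurable_const
    _ ≤ ∫⁻ l in Set.Ioi (0 : ℝ), 20 * ∫⁻ s,
          if ENNReal.ofReal (l / 2) < φ s then φ s else 0 := by
        refine setLIntegral_mono' measurableSet_Ioi fun l hl => ?_
        refine le_of_eq_of_le ?_ (hkey l hl)
        rw [← lintegral_indicator_const (measurableSet_lt measurable_const hM)]
        simp only [Set.indicator, Set.mem_ofPred_eq]
    _ = 20 * ∫⁻ s, ∫⁻ l in Set.Ioi (0 : ℝ),
          if ENNReal.ofReal (l / 2) < φ s then φ s else 0 := by
        rw [lintegral_const_mul' _ _ (by norm_num), lintegral_lintegral_swap]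
        refine Measurable.aemeasurable ?_
        exact Measurable.ite (measurableSet_lt (by fun_prop) (by fun_prop))
          (by fun_prop) measurable_const
    _ ≤ 20 * ∫⁻ s, 2 * φ s ^ 2 := by
        gcongr with s
        exact lintegral_ite_half_lt
    _ = 40 * ∫⁻ s, φ s ^ 2 := by
        rw [lintegral_const_mul' _ _ (by norm_num), ← mul_assoc]
        norm_num

lemma eLpNorm_two_sq {α : Type*} [MeasurableSpace α] (μ : Measure α) (f : α → ℂ) :
    eLpNorm f 2 μ ^ 2 = ∫⁻ x, ‖f x‖ₑ ^ 2 ∂μ := by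
  have h := eLpNorm_nnreal_pow_eq_lintegral (f := f) (μ := μ) (p := 2) (by norm_num)
  simpa using h

lemma continuous_fourierInv_of_integrable {h : ℝ → ℂ} (h1 : Integrable h) :
    Continuous (𝓕⁻ h) := by
  have : 𝓕⁻ h = fun w => 𝓕 h (-w) := by
    ext w; exact Real.fourierInv_eq_fourier_neg h w
  rw [this]
  exact (VectorFourier.fourierIntegral_continuous Real.continuous_fourierChar
    (by exact continuous_inner) h1).comp continuous_neg

lemma integral_fourierInv_smul_eq {f g : ℝ → ℂ} (hf : Integrable f) (hg : Integrable g) :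
    ∫ x, 𝓕⁻ f x • g x = ∫ x, f x • 𝓕⁻ g x := by
  have h := VectorFourier.integral_fourierIntegral_smul_eq_flip (L := -innerₗ ℝ)
    Real.continuous_fourierChar (by exact continuous_inner.neg) hf hg
  have hL : (-innerₗ ℝ).flip = -innerₗ ℝ := by
    ext; simp
  rw [hL] at h
  exact h

/-- Plancherel's theorem for integrable square-integrable functions on the line. -/
lemma lintegral_enorm_fourierInv_sq {h : ℝ → ℂ} (h1 : Integrable h) (h2 : MemLp h 2) :
    ∫⁻ s, ‖𝓕⁻ h s‖ₑ ^ 2 = ∫⁻ r, ‖h r‖ₑ ^ 2 := by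
  have hae : 𝓕⁻ h =ᵐ[volume] (𝓕⁻ (h2.toLp h) : Lp ℂ 2 (volume : Measure ℝ)) := by
    refine ae_eq_of_integral_contDiff_smul_eq
      (continuous_fourierInv_of_integrable h1).locallyIntegrable
      ((Lp.memLp _).locallyIntegrable (by norm_num)) fun g hg hgs => ?_
    let G : SchwartzMap ℝ ℂ :=
      (hgs.comp_left (g := ((↑) : ℝ → ℂ)) rfl).toSchwartzMap (Complex.ofRealCLM.contDiff.comp hg)
    have hG : ∀ x, G x = (g x : ℂ) := fun x => rfl
    have hlp := congrArg (fun T => T G) (Lp.fourierInv_toTemperedDistribution_eq (h2.toLp h))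
    simp only [TemperedDistribution.fourierInv_apply, Lp.toTemperedDistribution_apply] at hlp
    calc ∫ x, g x • 𝓕⁻ h x = ∫ x, G x • 𝓕⁻ h x := by simp [hG]
      _ = ∫ x, 𝓕⁻ (G : ℝ → ℂ) x • h x := (integral_fourierInv_smul_eq G.integrable h1).symm
      _ = ∫ x, (𝓕⁻ G) x • h2.toLp h x := by
        rw [SchwartzMap.fourierInv_coe]
        refine integral_congr_ae ?_
        filter_upwards [h2.coeFn_toLp] with x hx
        rw [hx]
      _ = ∫ x, g x • (𝓕⁻ (h2.toLp h) : Lp ℂ 2 (volume : Measure ℝ)) x := by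
        rw [hlp]; simp [hG]
  have hnorm : ‖(𝓕⁻ (h2.toLp h) : Lp ℂ 2 (volume : Measure ℝ))‖ₑ = ‖h2.toLp h‖ₑ := by
    have := Lp.norm_fourier_eq (𝓕⁻ (h2.toLp h))
    rw [FourierTransform.fourier_fourierInv_eq] at this
    rw [← ofReal_norm, ← ofReal_norm, this]
  rw [← eLpNorm_two_sq, ← eLpNorm_two_sq, eLpNorm_congr_ae hae, ← Lp.enorm_def, hnorm,
    Lp.enorm_toLp]

/-- Integration in polar coordinates for nonnegative functions. -/
lemma lintegral_polar {E : Type*} [NormedAddCommGroup E] [NormedSpace ℝ E] [Nontrivial E]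
    [MeasurableSpace E] [BorelSpace E] [FiniteDimensional ℝ E] (μ : Measure E)
    [μ.IsAddHaarMeasure] {F : E → ℝ≥0∞} (hF : Measurable F) :
    ∫⁻ x, F x ∂μ = ∫⁻ ω, (∫⁻ r in Set.Ioi (0 : ℝ),
      ENNReal.ofReal (r ^ (Module.finrank ℝ E - 1)) * F (r • (ω : E))) ∂μ.toSphere := by
  have hmeas : Measurable fun p : Metric.sphere (0 : E) 1 × Set.Ioi (0 : ℝ) =>
      F ((p.2 : ℝ) • (p.1 : E)) := hF.comp (by fun_prop)
  calc ∫⁻ x, F x ∂μ = ∫⁻ x : ({(0)}ᶜ : Set E), F x ∂(μ.comap (↑)) := by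
        rw [lintegral_subtype_comap (measurableSet_singleton _).compl F,
          restrict_compl_singleton]
    _ = ∫⁻ p, F ((p.2 : ℝ) • (p.1 : E))
          ∂μ.toSphere.prod (.volumeIoiPow (Module.finrank ℝ E - 1)) := by
        rw [← μ.measurePreserving_homeomorphUnitSphereProd.lintegral_comp hmeas]
        refine lintegral_congr fun x => ?_
        have hx : ‖(x : E)‖ ≠ 0 := norm_ne_zero_iff.2 x.2
        simp [smul_smul, hx]
    _ = _ := by
        rw [lintegral_prod _ hmeas.aemeasurable]
        refine lintegral_congr fun ω => ?_
        have hω : Measurable fun r : ℝ => F (r • (ω : E)) := hF.comp (by fun_prop)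
        rw [Measure.volumeIoiPow, lintegral_withDensity_eq_lintegral_mul _ (by fun_prop)
          (by exact hω.comp measurable_subtype_coe)]
        exact lintegral_subtype_comap measurableSet_Ioi
          fun r : ℝ => ENNReal.ofReal (r ^ (Module.finrank ℝ E - 1)) * F (r • (ω : E))

/-- Integration in polar coordinates for radial nonnegative functions. -/
lemma lintegral_fun_norm {E : Type*} [NormedAddCommGroup E] [NormedSpace ℝ E] [Nontrivial E]
    [MeasurableSpace E] [BorelSpace E] [FiniteDimensional ℝ E] (μ : Measure E)
    [μ.IsAddHaarMeasure] {F : ℝ → ℝ≥0∞} (hF : Measurable F) :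
    ∫⁻ x, F ‖x‖ ∂μ = μ.toSphere Set.univ * ∫⁻ r in Set.Ioi (0 : ℝ),
      ENNReal.ofReal (r ^ (Module.finrank ℝ E - 1)) * F r := by
  rw [lintegral_polar μ (F := fun x => F ‖x‖) (hF.comp measurable_norm), mul_comm,
    ← lintegral_const]
  refine lintegral_congr fun ω => setLIntegral_congr_fun measurableSet_Ioi fun r hr => ?_
  have hr : 0 < r := hr
  simp [norm_smul, abs_of_pos hr]

lemma integral_polar {E : Type*} [NormedAddCommGroup E] [NormedSpace ℝ E] [Nontrivial E]
    [MeasurableSpace E] [BorelSpace E] [FiniteDimensional ℝ E] (μ : Measure E)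
    [μ.IsAddHaarMeasure] {F : E → ℂ} (hF : Integrable F μ) :
    ∫ x, F x ∂μ = ∫ ω, (∫ r in Set.Ioi (0 : ℝ),
      ((r ^ (Module.finrank ℝ E - 1) : ℝ) : ℂ) * F (r • (ω : E))) ∂μ.toSphere := by
  have hpres := μ.measurePreserving_homeomorphUnitSphereProd
  have hemb := (homeomorphUnitSphereProd E).measurableEmbedding
  have hpt : ∀ x : ({0}ᶜ : Set E), F ((((homeomorphUnitSphereProd E) x).2 : ℝ) •
      (((homeomorphUnitSphereProd E) x).1 : E)) = F x := by
    intro x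
    have hx : ‖(x : E)‖ ≠ 0 := norm_ne_zero_iff.2 x.2
    simp [smul_smul, hx]
  have hint : Integrable (fun p : Metric.sphere (0 : E) 1 × Set.Ioi (0 : ℝ) =>
      F ((p.2 : ℝ) • (p.1 : E))) (μ.toSphere.prod (.volumeIoiPow (Module.finrank ℝ E - 1))) := by
    rw [← hpres.integrable_comp_emb hemb]
    simp only [Function.comp_def, hpt]
    have := hF.integrableOn (s := ({0}ᶜ : Set E))
    rwa [integrableOn_iff_comap_subtypeVal (measurableSet_singleton _).compl] at this
  calc ∫ x, F x ∂μ = ∫ x : ({(0)}ᶜ : Set E), F x ∂(μ.comap (↑)) := by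
        rw [integral_subtype_comap (measurableSet_singleton _).compl F,
          restrict_compl_singleton]
    _ = ∫ p, F ((p.2 : ℝ) • (p.1 : E))
          ∂μ.toSphere.prod (.volumeIoiPow (Module.finrank ℝ E - 1)) := by
        rw [← hpres.integral_comp hemb]
        simp only [hpt]
    _ = _ := by
        rw [integral_prod _ hint]
        refine integral_congr_ae (ae_of_all _ fun ω => ?_)
        simp only [Measure.volumeIoiPow, ENNReal.ofReal]
        rw [integral_withDensity_eq_integral_smul (by fun_prop)]
        rw [integral_subtype_comap measurableSet_Ioi fun r : ℝ =>
          Real.toNNReal (r ^ (Module.finrank ℝ E - 1)) • F (r • (ω : E))]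
        refine setIntegral_congr_fun measurableSet_Ioi fun r hr => ?_
        rw [NNReal.smul_def, Real.coe_toNNReal _ (pow_nonneg (le_of_lt hr) _), Complex.real_smul]

/-- Splitting off the first coordinate of Euclidean space. -/
lemma lintegral_euclidean_succ (m : ℕ) {F : ℝ → ℝ → ℝ≥0∞}
    (hF : Measurable (Function.uncurry F)) :
    ∫⁻ ξ : Rn (m + 1), F ‖ξ‖ (ξ 0) = ∫⁻ s : ℝ, ∫⁻ η : Rn m, F (√(s ^ 2 + ‖η‖ ^ 2)) s := by
  have hnorm : ∀ (s : ℝ) (η : Fin m → ℝ),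
      √(s ^ 2 + ‖(WithLp.toLp 2 η : Rn m)‖ ^ 2) = √(s ^ 2 + ∑ i, η i ^ 2) := by
    intro s η
    rw [EuclideanSpace.norm_sq_eq]; simp
  calc ∫⁻ ξ : Rn (m + 1), F ‖ξ‖ (ξ 0)
      = ∫⁻ v : Fin (m + 1) → ℝ, F (√(∑ i, v i ^ 2)) (v 0) := by
        rw [← (PiLp.volume_preserving_ofLp (Fin (m + 1))).lintegral_comp]
        · simp [EuclideanSpace.norm_eq]
        · exact hF.comp (f := fun v : Fin (m + 1) → ℝ => (√(∑ i, v i ^ 2), v 0)) (by fun_prop)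
    _ = ∫⁻ p : ℝ × (Fin m → ℝ), F (√(p.1 ^ 2 + ∑ i, p.2 i ^ 2)) p.1 := by
        rw [← (volume_preserving_piFinSuccAbove (fun _ : Fin (m + 1) => ℝ) 0).lintegral_comp]
        · simp [Fin.sum_univ_succ, MeasurableEquiv.piFinSuccAbove, Fin.tail]
        · exact hF.comp (f := fun p : ℝ × (Fin m → ℝ) => (√(p.1 ^ 2 + ∑ i, p.2 i ^ 2), p.1))
            (by fun_prop)
    _ = ∫⁻ s : ℝ, ∫⁻ η : Fin m → ℝ, F (√(s ^ 2 + ∑ i, η i ^ 2)) s := by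
        rw [Measure.volume_eq_prod, lintegral_prod]
        exact (hF.comp (f := fun p : ℝ × (Fin m → ℝ) => (√(p.1 ^ 2 + ∑ i, p.2 i ^ 2), p.1))
            (by fun_prop)).aemeasurable
    _ = _ := by
        refine lintegral_congr fun s => ?_
        rw [← (PiLp.volume_preserving_toLp (Fin m)).lintegral_comp]
        · simp only [hnorm]
        · exact hF.comp (f := fun η : Rn m => (√(s ^ 2 + ‖η‖ ^ 2), s)) (by fun_prop)

lemma lintegral_sin_mul_comp_cos (φ : ℝ → ℝ≥0∞) :
    ∫⁻ θ in Set.Ioo 0 π, ENNReal.ofReal (Real.sin θ) * φ (Real.cos θ) =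
      ∫⁻ v in Set.Ioo (-1 : ℝ) 1, φ v := by
  have himg : Real.cos '' Set.Ioo 0 π = Set.Ioo (-1 : ℝ) 1 := by
    ext v
    constructor
    · rintro ⟨θ, hθ, rfl⟩
      have hs := Real.sin_pos_of_mem_Ioo hθ
      have := Real.sin_sq_add_cos_sq θ
      constructor <;> nlinarith [sq_pos_of_pos hs]
    · rintro ⟨h1, h2⟩
      exact ⟨Real.arccos v, ⟨Real.arccos_pos.2 h2, Real.arccos_lt_pi.2 h1⟩,
        Real.cos_arccos h1.le h2.le⟩
  rw [← himg, lintegral_image_eq_lintegral_abs_deriv_mul measurableSet_Ioo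
    (fun θ _ => (Real.hasDerivAt_cos θ).hasDerivWithinAt)
    (Real.injOn_cos.mono Set.Ioo_subset_Icc_self)]
  refine setLIntegral_congr_fun measurableSet_Ioo fun θ hθ => ?_
  rw [abs_neg, abs_of_pos (Real.sin_pos_of_mem_Ioo hθ)]

/-- The weight `r ^ (-m)` on the unit interval. -/
def unitWeight (m : ℕ) (r : ℝ) : ℝ≥0∞ :=
  (Set.Ioo (0 : ℝ) 1).indicator (fun r => (ENNReal.ofReal (r ^ m))⁻¹) r

lemma measurable_unitWeight (m : ℕ) : Measurable (unitWeight m) :=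
  Measurable.indicator (by fun_prop) measurableSet_Ioo

lemma ofReal_pow_mul_unitWeight (m : ℕ) (r : ℝ) :
    ENNReal.ofReal (r ^ m) * unitWeight m r = (Set.Ioo (0 : ℝ) 1).indicator 1 r := by
  by_cases hr : r ∈ Set.Ioo (0 : ℝ) 1
  · simp only [unitWeight, Set.indicator_of_mem hr, Pi.one_apply]
    exact ENNReal.mul_inv_cancel (by simpa using pow_pos hr.1 m) ENNReal.ofReal_ne_top
  · simp [unitWeight, Set.indicator_of_notMem hr]

lemma lintegral_unitWeight_mul (m : ℕ) (c : ℝ≥0∞) :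
    ∫⁻ r in Set.Ioi (0 : ℝ), ENNReal.ofReal (r ^ m) * (unitWeight m r * c) = c := by
  simp_rw [← mul_assoc, ofReal_pow_mul_unitWeight]
  rw [lintegral_mul_const _ (measurable_one.indicator measurableSet_Ioo),
    lintegral_indicator_one measurableSet_Ioo, Measure.restrict_apply measurableSet_Ioo,
    Set.inter_eq_left.2 (fun r hr => hr.1)]
  simp

/-- The slice measure of the sphere has bounded density in dimension at least three: first
coordinate. -/
lemma lintegral_unitWeight_mul_coord_le {m : ℕ} (hm : 2 ≤ m) {φ : ℝ → ℝ≥0∞}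
    (hφ : Measurable φ) :
    ∫⁻ ξ : Rn (m + 1), unitWeight m ‖ξ‖ * φ (ξ 0 / ‖ξ‖) ≤
      (volume : Measure (Rn m)).toSphere Set.univ * ∫⁻ v in Set.Ioo (-1 : ℝ) 1, φ v := by
  have : Nonempty (Fin m) := ⟨⟨0, by omega⟩⟩
  have hG : Measurable (Function.uncurry fun r s : ℝ => unitWeight m r * φ (s / r)) :=
    ((measurable_unitWeight m).comp measurable_fst).mul (hφ.comp (by fun_prop))
  set K := (volume : Measure (Rn m)).toSphere Set.univ with hK
  have hKtop : K ≠ ⊤ := measure_ne_top _ _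
  let P : ℝ × ℝ → ℝ≥0∞ := fun p => (Set.Ioi (0 : ℝ)).indicator (fun ρ =>
    ENNReal.ofReal (ρ ^ (m - 1)) *
      (unitWeight m (√(p.1 ^ 2 + ρ ^ 2)) * φ (p.1 / √(p.1 ^ 2 + ρ ^ 2)))) p.2
  have hP : Measurable P := by
    have : P = (Prod.snd ⁻¹' Set.Ioi (0 : ℝ)).indicator fun p : ℝ × ℝ =>
        ENNReal.ofReal (p.2 ^ (m - 1)) *
          (unitWeight m (√(p.1 ^ 2 + p.2 ^ 2)) * φ (p.1 / √(p.1 ^ 2 + p.2 ^ 2))) := by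
      ext p; simp [P, Set.indicator]
    rw [this]
    refine Measurable.indicator ?_ (measurable_snd measurableSet_Ioi)
    exact Measurable.mul (by fun_prop)
      (((measurable_unitWeight m).comp (by fun_prop)).mul (hφ.comp (by fun_prop)))
  calc ∫⁻ ξ : Rn (m + 1), unitWeight m ‖ξ‖ * φ (ξ 0 / ‖ξ‖)
      = ∫⁻ s : ℝ, K * ∫⁻ ρ, P (s, ρ) := by
        rw [lintegral_euclidean_succ m hG]
        refine lintegral_congr fun s => ?_
        rw [lintegral_fun_norm (volume : Measure (Rn m)) (F := fun ρ =>
          unitWeight m (√(s ^ 2 + ρ ^ 2)) * φ (s / √(s ^ 2 + ρ ^ 2)))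
          (((measurable_unitWeight m).comp (by fun_prop)).mul (hφ.comp (by fun_prop))),
          finrank_euclideanSpace_fin, ← lintegral_indicator measurableSet_Ioi]
    _ = K * ∫⁻ p, P p := by
        rw [lintegral_const_mul' _ _ hKtop, Measure.volume_eq_prod,
          lintegral_prod _ hP.aemeasurable]
    _ ≤ K * ∫⁻ p : ℝ × ℝ, (Set.Ioo (0 : ℝ) 1).indicator 1 p.1 *
          (Set.Ioo 0 π).indicator (fun θ => ENNReal.ofReal (Real.sin θ) * φ (Real.cos θ)) p.2 := by
        rw [← lintegral_comp_polarCoord_symm,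
          ← lintegral_indicator polarCoord.open_target.measurableSet]
        refine mul_le_mul_right (lintegral_mono (Set.indicator_le' ?_ ?_)) _
        · rintro ⟨r, θ⟩ ⟨hr, hθ⟩
          simp only [Set.mem_Ioi] at hr
          by_cases hpos : θ ∈ Set.Ioo 0 π
          · have hs := Real.sin_pos_of_mem_Ioo hpos
            have hsq : √((r * Real.cos θ) ^ 2 + (r * Real.sin θ) ^ 2) = r := by
              rw [show (r * Real.cos θ) ^ 2 + (r * Real.sin θ) ^ 2 = r ^ 2 by
                linear_combination r ^ 2 * Real.sin_sq_add_cos_sq θ, Real.sqrt_sq hr.le]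
            have hmem : r * Real.sin θ ∈ Set.Ioi (0 : ℝ) := mul_pos hr hs
            simp only [P, polarCoord_symm_apply, Set.indicator_of_mem hpos,
              Set.indicator_of_mem hmem, hsq, mul_div_cancel_left₀ _ hr.ne', smul_eq_mul]
            rw [← ofReal_pow_mul_unitWeight m r]
            have hpow : r * (r * Real.sin θ) ^ (m - 1) ≤ r ^ m * Real.sin θ := by
              obtain ⟨k, rfl⟩ : ∃ k, m = k + 2 := ⟨m - 2, by omega⟩
              have : Real.sin θ ^ (k + 1) ≤ Real.sin θ :=
                pow_le_of_le_one hs.le (Real.sin_le_one θ) (by omega)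
              calc r * (r * Real.sin θ) ^ (k + 2 - 1) = r ^ (k + 2) * Real.sin θ ^ (k + 1) := by
                    rw [show k + 2 - 1 = k + 1 by omega, mul_pow]; ring
                _ ≤ _ := by gcongr
            calc ENNReal.ofReal r * (ENNReal.ofReal ((r * Real.sin θ) ^ (m - 1)) *
                  (unitWeight m r * φ (Real.cos θ)))
                = ENNReal.ofReal (r * (r * Real.sin θ) ^ (m - 1)) *
                  (unitWeight m r * φ (Real.cos θ)) := by
                  rw [ENNReal.ofReal_mul hr.le, mul_assoc]
              _ ≤ ENNReal.ofReal (r ^ m * Real.sin θ) * (unitWeight m r * φ (Real.cos θ)) :=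
                  mul_le_mul_left (ENNReal.ofReal_le_ofReal hpow) _
              _ = _ := by
                  rw [ENNReal.ofReal_mul (by positivity)]; ring
          · have hs : Real.sin θ ≤ 0 := by
              have h0 : θ ≤ 0 := by
                by_contra! h0
                exact hpos ⟨h0, hθ.2⟩
              exact Real.sin_nonpos_of_nonpos_of_neg_pi_le h0 hθ.1.le
            have hmem : r * Real.sin θ ∉ Set.Ioi (0 : ℝ) := by
              simpa using mul_nonpos_of_nonneg_of_nonpos hr.le hs
            simp [P, polarCoord_symm_apply, Set.indicator_of_notMem hmem]
        · exact fun _ _ => zero_le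
    _ = K * ∫⁻ v in Set.Ioo (-1 : ℝ) 1, φ v := by
        rw [Measure.volume_eq_prod, lintegral_prod_mul
          (measurable_one.indicator measurableSet_Ioo).aemeasurable
          (Measurable.indicator (by fun_prop) measurableSet_Ioo).aemeasurable,
          lintegral_indicator_one measurableSet_Ioo, lintegral_indicator measurableSet_Ioo,
          lintegral_sin_mul_comp_cos]
        simp

/-- In dimension at least three, the projection of the surface measure of the unit sphere to a
line has bounded density. -/
lemma lintegral_sphere_inner_le {m : ℕ} (hm : 2 ≤ m) {φ : ℝ → ℝ≥0∞} (hφ : Measurable φ)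
    {e : Rn (m + 1)} (he : ‖e‖ = 1) :
    ∫⁻ ω, φ (inner ℝ e (ω : Rn (m + 1))) ∂(volume : Measure (Rn (m + 1))).toSphere ≤
      (volume : Measure (Rn m)).toSphere Set.univ * ∫⁻ v in Set.Ioo (-1 : ℝ) 1, φ v := by
  obtain ⟨b, hb⟩ := Orthonormal.exists_orthonormalBasis_extension_of_card_eq (𝕜 := ℝ)
    (E := Rn (m + 1)) (ι := Fin (m + 1)) (by simp) (v := fun _ => e) (s := {0})
    (by
      rw [orthonormal_iff_ite]
      rintro ⟨i, hi⟩ ⟨j, hj⟩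
      simp only [Set.mem_singleton_iff] at hi hj
      subst hi; subst hj
      simp [he])
  have hb0 : b 0 = e := hb 0 rfl
  have hcoord : Measurable fun ξ : Rn (m + 1) => unitWeight m ‖ξ‖ * φ (ξ 0 / ‖ξ‖) :=
    ((measurable_unitWeight m).comp measurable_norm).mul (hφ.comp (by fun_prop))
  have hinner : Measurable fun ξ : Rn (m + 1) => unitWeight m ‖ξ‖ * φ (inner ℝ e ξ / ‖ξ‖) :=
    ((measurable_unitWeight m).comp measurable_norm).mul (hφ.comp (by fun_prop))
  refine le_of_eq_of_le ?_ (lintegral_unitWeight_mul_coord_le hm hφ)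
  rw [← b.repr.measurePreserving.lintegral_comp hcoord]
  simp only [b.repr_apply_apply, hb0, LinearIsometryEquiv.norm_map]
  rw [lintegral_polar _ hinner]
  refine lintegral_congr fun ω => ?_
  rw [finrank_euclideanSpace_fin, Nat.add_sub_cancel]
  refine (lintegral_unitWeight_mul m _).symm.trans ?_
  refine setLIntegral_congr_fun measurableSet_Ioi fun r hr => ?_
  have hr : 0 < r := hr
  simp [norm_smul, abs_of_pos hr, inner_smul_right, mul_div_cancel_left₀ _ hr.ne']

lemma setLIntegral_image_affine {a : ℝ} (ha : 0 < a) (b : ℝ) (ψ : ℝ → ℝ≥0∞) {s : Set ℝ}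
    (hs : MeasurableSet s) :
    ∫⁻ u in Set.image (fun v => b + a * v) s, ψ u = ENNReal.ofReal a * ∫⁻ v in s, ψ (b + a * v) := by
  rw [lintegral_image_eq_lintegral_abs_deriv_mul (f' := fun _ => a) hs
    (fun v _ => by simpa using (((hasDerivAt_id v).const_mul a).const_add b).hasDerivWithinAt)
    (fun v _ w _ h => by simpa [ha.ne'] using h), abs_of_pos ha,
    lintegral_const_mul' _ _ ENNReal.ofReal_ne_top]

lemma lintegral_Ioo_affine_le_maximalFn (φ : ℝ → ℝ≥0∞) (t : ℝ) {R : ℝ} (hR : 0 < R) :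
    ∫⁻ v in Set.Ioo (-1 : ℝ) 1, φ (t + R * v) ≤ 4 * maximalFn φ t := by
  have himg : Set.image (fun v => t + R * v) (Set.Ioo (-1) 1) = Metric.ball t R := by
    ext u
    rw [Real.ball_eq_Ioo]
    constructor
    · rintro ⟨v, ⟨h1, h2⟩, rfl⟩
      constructor <;> dsimp only <;> nlinarith
    · rintro ⟨h1, h2⟩
      refine ⟨(u - t) / R, ⟨?_, ?_⟩, by field_simp; ring⟩
      · rw [lt_div_iff₀ hR]; linarith
      · rw [div_lt_iff₀ hR]; linarith
  have h := setLIntegral_ball_le_maximalFn φ t hR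
  rw [← himg, setLIntegral_image_affine hR t φ measurableSet_Ioo, mul_comm 4 R,
    ENNReal.ofReal_mul hR.le, mul_assoc] at h
  have h0 : ENNReal.ofReal R ≠ 0 := by simpa using hR
  simpa using (ENNReal.mul_le_mul_iff_right h0 ENNReal.ofReal_ne_top).1 h

lemma lintegral_comp_div {a : ℝ} (ha : 0 < a) (ψ : ℝ → ℝ≥0∞) :
    ∫⁻ t, ψ (t / a) = ENNReal.ofReal a * ∫⁻ t, ψ t := by
  have h := setLIntegral_image_affine (inv_pos.2 ha) 0 ψ MeasurableSet.univ
  have himg : Set.image (fun v : ℝ => 0 + a⁻¹ * v) Set.univ = Set.univ := by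
    rw [Set.image_univ]
    exact Set.range_eq_univ.2 fun u => ⟨a * u, by field_simp; ring⟩
  rw [himg, setLIntegral_univ, setLIntegral_univ] at h
  rw [h, ← mul_assoc, ← ENNReal.ofReal_mul ha.le, mul_inv_cancel₀ ha.ne', ENNReal.ofReal_one,
    one_mul]
  simp [div_eq_inv_mul]

lemma IsRadialN.fourier {n : ℕ} {f : Rn n → ℂ} (hf : IsRadialN f) : IsRadialN (𝓕 f) := by
  intro x y hxy
  let A := (ℝ ∙ (x - y))ᗮ.reflection
  have hA : A x = y := Submodule.reflection_sub hxy
  have hfA : f ∘ A = f := by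
    ext z; exact hf _ _ (A.norm_map z)
  rw [← hA, ← Real.fourier_comp_linearIsometry A f x, hfA]

lemma continuous_fourier {n : ℕ} (f : Rn n → ℂ) : Continuous (𝓕 f) := by
  by_cases hf : Integrable f
  · exact VectorFourier.fourierIntegral_continuous Real.continuous_fourierChar
      (by exact continuous_inner) hf
  · have : 𝓕 f = fun _ => 0 := by
      ext ξ
      refine integral_undef ?_
      rwa [VectorFourier.fourierIntegral_convergent_iff Real.continuous_fourierChar
        (by exact continuous_inner)]
    rw [this]
    exact continuous_const

/-- The profile `r ^ m g(r)` on the positive half-line of a radial function `F` on `ℝ^(m+1)` with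
`F ξ = g(|ξ|)`. -/
def radialProfile {m : ℕ} (F : Rn (m + 1) → ℂ) : ℝ → ℂ :=
  (Set.Ioi (0 : ℝ)).indicator fun r =>
    ((r ^ m : ℝ) : ℂ) * F (r • EuclideanSpace.single 0 1)

lemma IsRadialN.eq_norm_smul {m : ℕ} {F : Rn (m + 1) → ℂ} (hF : IsRadialN F) (ξ : Rn (m + 1)) :
    F ξ = F (‖ξ‖ • EuclideanSpace.single 0 1) :=
  hF _ _ (by simp [norm_smul])

lemma integrable_radialProfile {m : ℕ} {F : Rn (m + 1) → ℂ} (hF : IsRadialN F)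
    (hint : Integrable F) : Integrable (radialProfile F) := by
  have h := (integrable_fun_norm_addHaar (volume : Measure (Rn (m + 1)))
    (f := fun r : ℝ => F (r • EuclideanSpace.single 0 1))).1
    (hint.congr (ae_of_all _ hF.eq_norm_smul))
  rw [finrank_euclideanSpace_fin, Nat.add_sub_cancel,
    ← integrable_indicator_iff measurableSet_Ioi] at h
  simpa [radialProfile] using h

lemma lintegral_enorm_radialProfile_sq {m : ℕ} {F : Rn (m + 1) → ℂ} (hF : IsRadialN F)
    (hc : Continuous F) :
    ∫⁻ ξ, ‖‖ξ‖ ^ ((m : ℝ) / 2) • F ξ‖ₑ ^ 2 =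
      (volume : Measure (Rn (m + 1))).toSphere Set.univ * ∫⁻ r, ‖radialProfile F r‖ₑ ^ 2 := by
  have hmeas : Measurable fun r : ℝ =>
      ‖r ^ ((m : ℝ) / 2) • F (r • EuclideanSpace.single 0 1)‖ₑ ^ 2 := by
    have : Measurable fun r : ℝ => F (r • EuclideanSpace.single 0 1) :=
      (hc.comp (by fun_prop)).measurable
    exact ((Measurable.smul (by fun_prop : Measurable fun r : ℝ => r ^ ((m : ℝ) / 2))
      this).enorm).pow_const 2
  calc ∫⁻ ξ, ‖‖ξ‖ ^ ((m : ℝ) / 2) • F ξ‖ₑ ^ 2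
      = ∫⁻ ξ : Rn (m + 1),
          ‖‖ξ‖ ^ ((m : ℝ) / 2) • F (‖ξ‖ • EuclideanSpace.single 0 1)‖ₑ ^ 2 :=
        lintegral_congr fun ξ => by rw [← hF.eq_norm_smul]
    _ = _ := by
        rw [lintegral_fun_norm _ hmeas, finrank_euclideanSpace_fin, Nat.add_sub_cancel,
          ← lintegral_indicator measurableSet_Ioi]
        congr 1
        refine lintegral_congr fun r => ?_
        by_cases hr : 0 < r
        · have hrm : ‖((r ^ m : ℝ) : ℂ)‖ₑ = ENNReal.ofReal (r ^ m) := by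
            rw [← ofReal_norm, Complex.norm_real, Real.norm_of_nonneg (by positivity)]
          have hrs : ‖r ^ ((m : ℝ) / 2)‖ₑ ^ 2 = ENNReal.ofReal (r ^ m) := by
            rw [Real.enorm_of_nonneg (by positivity), ← ENNReal.ofReal_pow (by positivity),
              ← Real.rpow_mul_natCast hr.le]
            simp
          simp only [radialProfile, Set.indicator_of_mem (Set.mem_Ioi.2 hr), enorm_mul, enorm_smul,
            mul_pow, hrm, hrs]
          ring
        · simp [radialProfile, hr]

lemma integrable_halfWave_integrand_iff {n : ℕ} (f : Rn n → ℂ) (t : ℝ) (x : Rn n) :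
    Integrable (fun ξ : Rn n => Complex.exp (((2 * π * inner ℝ ξ x : ℝ) : ℂ) * I) •
      (Complex.exp (I * (t : ℂ) * (‖ξ‖ : ℂ)) * 𝓕 f ξ)) ↔ Integrable (𝓕 f) := by
  have hc := continuous_fourier f
  refine integrable_congr' (Continuous.aestronglyMeasurable (by fun_prop))
    hc.aestronglyMeasurable (ae_of_all _ fun ξ => ?_)
  have h : I * (t : ℂ) * (‖ξ‖ : ℂ) = ((t * ‖ξ‖ : ℝ) : ℂ) * I := by push_cast; ring
  rw [norm_smul, norm_mul, h, Complex.norm_exp_ofReal_mul_I, Complex.norm_exp_ofReal_mul_I,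
    one_mul, one_mul]

lemma halfWave_of_not_integrable {n : ℕ} {f : Rn n → ℂ} (hf : ¬ Integrable (𝓕 f)) (t : ℝ) :
    halfWave t f = 0 := by
  ext x
  rw [halfWave, Real.fourierInv_eq']
  exact integral_undef (mt (integrable_halfWave_integrand_iff f t x).1 hf)

/-- The radial half-wave is a spherical average of a one-dimensional profile. -/
lemma halfWave_eq_integral_sphere {m : ℕ} {f : Rn (m + 1) → ℂ} (hf : IsRadialN f)
    (hint : Integrable (𝓕 f)) (t : ℝ) (x : Rn (m + 1)) :
    halfWave t f x = ∫ ω, 𝓕⁻ (radialProfile (𝓕 f)) (t / (2 * π) + inner ℝ x (ω : Rn (m + 1)))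
      ∂(volume : Measure (Rn (m + 1))).toSphere := by
  rw [halfWave, Real.fourierInv_eq',
    integral_polar _ ((integrable_halfWave_integrand_iff f t x).2 hint),
    finrank_euclideanSpace_fin, Nat.add_sub_cancel]
  refine integral_congr_ae (ae_of_all _ fun ω => ?_)
  dsimp only
  rw [Real.fourierInv_eq', ← integral_indicator measurableSet_Ioi]
  refine integral_congr_ae (ae_of_all _ fun r => ?_)
  by_cases hr : 0 < r
  · have hω : ‖(ω : Rn (m + 1))‖ = 1 := norm_eq_of_mem_sphere ω
    have hnorm : ‖r • (ω : Rn (m + 1))‖ = r := by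
      rw [norm_smul, hω, mul_one, Real.norm_of_nonneg hr.le]
    have hexp : Complex.exp (((2 * π * inner ℝ r (t / (2 * π) + inner ℝ x (ω : Rn (m + 1))) : ℝ)
          : ℂ) * I) =
        Complex.exp (((2 * π * inner ℝ (r • (ω : Rn (m + 1))) x : ℝ) : ℂ) * I) *
          Complex.exp (I * (t : ℂ) * (r : ℂ)) := by
      rw [← Complex.exp_add, real_inner_smul_left, real_inner_comm (ω : Rn (m + 1)) x]
      congr 1
      have hπ : (π : ℂ) ≠ 0 := by exact_mod_cast Real.pi_ne_zero
      simp only [RCLike.inner_apply, conj_trivial]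
      push_cast
      field_simp
      ring
    simp only [radialProfile, Set.indicator_of_mem (Set.mem_Ioi.2 hr), hf.fourier.eq_norm_smul
      (r • (ω : Rn (m + 1))), hnorm, hexp, smul_eq_mul]
    ring
  · simp [radialProfile, hr]

lemma enorm_halfWave_le_maximalFn {m : ℕ} (hm : 2 ≤ m) {f : Rn (m + 1) → ℂ} (hf : IsRadialN f)
    (hint : Integrable (𝓕 f)) (t : ℝ) {x : Rn (m + 1)} (hx : x ≠ 0) :
    ‖halfWave t f x‖ₑ ≤ (volume : Measure (Rn m)).toSphere Set.univ *
      (4 * maximalFn (fun s => ‖𝓕⁻ (radialProfile (𝓕 f)) s‖ₑ) (t / (2 * π))) := by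
  set φ : ℝ → ℝ≥0∞ := fun s => ‖𝓕⁻ (radialProfile (𝓕 f)) s‖ₑ
  have hφ : Measurable φ :=
    (continuous_fourierInv_of_integrable
      (integrable_radialProfile hf.fourier hint)).enorm.measurable
  have hR : 0 < ‖x‖ := norm_pos_iff.2 hx
  have he : ‖‖x‖⁻¹ • x‖ = 1 := norm_smul_inv_norm hx
  rw [halfWave_eq_integral_sphere hf hint]
  calc _ ≤ ∫⁻ ω, φ (t / (2 * π) + inner ℝ x (ω : Rn (m + 1)))
        ∂(volume : Measure (Rn (m + 1))).toSphere := enorm_integral_le_lintegral_enorm _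
    _ = ∫⁻ ω, φ (t / (2 * π) + ‖x‖ * inner ℝ (‖x‖⁻¹ • x) (ω : Rn (m + 1)))
        ∂(volume : Measure (Rn (m + 1))).toSphere := by
      simp_rw [real_inner_smul_left, mul_inv_cancel_left₀ hR.ne']
    _ ≤ (volume : Measure (Rn m)).toSphere Set.univ *
        ∫⁻ v in Set.Ioo (-1 : ℝ) 1, φ (t / (2 * π) + ‖x‖ * v) :=
      lintegral_sphere_inner_le (φ := fun v => φ (t / (2 * π) + ‖x‖ * v)) hm
        (hφ.comp (by fun_prop)) he
    _ ≤ _ := by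
      gcongr
      exact lintegral_Ioo_affine_le_maximalFn φ _ hR

lemma lintegral_eLpNorm_halfWave_sq_le {m : ℕ} (hm : 2 ≤ m) {f : Rn (m + 1) → ℂ}
    (hf : IsRadialN f) (hint : Integrable (𝓕 f)) (h2 : MemLp (radialProfile (𝓕 f)) 2) :
    ∫⁻ t, eLpNorm (halfWave t f) ⊤ volume ^ 2 ≤
      ((volume : Measure (Rn m)).toSphere Set.univ * 4) ^ 2 * ENNReal.ofReal (2 * π) * 40 *
        ∫⁻ r, ‖radialProfile (𝓕 f) r‖ₑ ^ 2 := by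
  set h := radialProfile (𝓕 f)
  set φ : ℝ → ℝ≥0∞ := fun s => ‖𝓕⁻ h s‖ₑ
  set K := (volume : Measure (Rn m)).toSphere Set.univ
  have h1 : Integrable h := integrable_radialProfile hf.fourier hint
  have hφ : Measurable φ := (continuous_fourierInv_of_integrable h1).enorm.measurable
  have hbound (s : ℝ) : φ s ≤ ∫⁻ r, ‖h r‖ₑ := by
    refine (enorm_integral_le_lintegral_enorm _).trans (le_of_eq (lintegral_congr fun r => ?_))
    rw [← ofReal_norm, ← ofReal_norm, Circle.norm_smul]
  have hpt (t : ℝ) : eLpNorm (halfWave t f) ⊤ volume ≤ K * 4 * maximalFn φ (t / (2 * π)) := by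
    rw [eLpNorm_exponent_top]
    refine eLpNormEssSup_le_of_ae_enorm_bound ?_
    filter_upwards [Measure.ae_ne volume (0 : Rn (m + 1))] with x hx
    rw [mul_assoc]
    exact enorm_halfWave_le_maximalFn hm hf hint t hx
  calc ∫⁻ t, eLpNorm (halfWave t f) ⊤ volume ^ 2
      ≤ ∫⁻ t, (K * 4) ^ 2 * maximalFn φ (t / (2 * π)) ^ 2 := by
        refine lintegral_mono fun t => ?_
        rw [← mul_pow]
        gcongr
        exact hpt t
    _ = (K * 4) ^ 2 * ENNReal.ofReal (2 * π) * ∫⁻ t, maximalFn φ t ^ 2 := by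
        rw [lintegral_const_mul' _ _ (by finiteness),
          lintegral_comp_div (ψ := fun t => maximalFn φ t ^ 2) (by positivity), mul_assoc]
    _ ≤ (K * 4) ^ 2 * ENNReal.ofReal (2 * π) * (40 * ∫⁻ s, φ s ^ 2) := by
        gcongr
        exact lintegral_maximalFn_sq_le hφ h1.2.ne hbound
    _ = _ := by rw [lintegral_enorm_fourierInv_sq h1 h2, ← mul_assoc]

/-- Endpoint Strichartz estimate for the half-wave flow with radial data. -/
theorem endpoint_strichartz_halfwave_radial (n : ℕ) (hn : 3 ≤ n) :
    ∃ C : ℝ≥0, ∀ f : Rn n → ℂ, IsRadialN f →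
      L2LinfN (fun t => halfWave t f) ≤ (C : ℝ≥0∞) * hSobN (((n : ℝ) - 1) / 2) f := by
  obtain ⟨m, rfl⟩ : ∃ m, n = m + 1 := ⟨n - 1, by omega⟩
  have hm : 2 ≤ m := by omega
  set σ := (volume : Measure (Rn (m + 1))).toSphere Set.univ with hσ
  have hσ0 : σ ≠ 0 := by
    rw [hσ, Measure.toSphere_apply_univ]
    simp [(Metric.measure_ball_pos volume (0 : Rn (m + 1)) one_pos).ne']
  have hσt : σ ≠ ⊤ := measure_ne_top _ _
  set A := ((volume : Measure (Rn m)).toSphere Set.univ * 4) ^ 2 * ENNReal.ofReal (2 * π) * 40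
  have hA : A ≠ ⊤ := by finiteness
  have hAσ : (A / σ) ^ (1 / 2 : ℝ) ≠ ⊤ :=
    ENNReal.rpow_ne_top_of_nonneg (by norm_num) (ENNReal.div_ne_top hA hσ0)
  refine ⟨((A / σ) ^ (1 / 2 : ℝ)).toNNReal + 1, fun f hf => ?_⟩
  by_cases hint : Integrable (𝓕 f)
  swap
  · simp [L2LinfN, halfWave_of_not_integrable hint]
  set S := hSobN ((((m + 1 : ℕ) : ℝ) - 1) / 2) f with hS
  by_cases hSt : S = ⊤
  · rw [hSt, ENNReal.mul_top (by simp)]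
    exact le_top
  have hsq : S ^ 2 = σ * ∫⁻ r, ‖radialProfile (𝓕 f) r‖ₑ ^ 2 := by
    rw [hS, hSobN, eLpNorm_two_sq, Nat.cast_add_one, add_sub_cancel_right,
      lintegral_enorm_radialProfile_sq hf.fourier (continuous_fourier f)]
  have h2 : MemLp (radialProfile (𝓕 f)) 2 := by
    refine ⟨(integrable_radialProfile hf.fourier hint).1, ?_⟩
    by_contra! htop
    have := eLpNorm_two_sq volume (radialProfile (𝓕 f))
    rw [top_le_iff.1 htop] at this
    rw [← this] at hsq
    simp [ENNReal.mul_top hσ0] at hsq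
    exact hSt hsq
  have hle : ∫⁻ t, eLpNorm (halfWave t f) ⊤ volume ^ 2 ≤ A / σ * S ^ 2 := by
    rw [hsq, ← mul_assoc, ENNReal.div_mul_cancel hσ0 hσt]
    exact lintegral_eLpNorm_halfWave_sq_le hm hf hint h2
  calc L2LinfN (fun t => halfWave t f) ≤ (A / σ * S ^ 2) ^ (1 / 2 : ℝ) := by
        rw [L2LinfN]
        gcongr
    _ = (A / σ) ^ (1 / 2 : ℝ) * S := by
        rw [ENNReal.mul_rpow_of_nonneg _ _ (by norm_num), ← ENNReal.rpow_natCast,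
          ← ENNReal.rpow_mul]
        norm_num
    _ ≤ _ := by
        gcongr
        rw [ENNReal.coe_add, ENNReal.coe_toNNReal hAσ]
        exact le_self_add
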